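/- Let ℱ be a separable family of measurable functions f : 𝒳 → ℝ with measurable envelope F, and for α ∈ ℝ let 𝒞_α = {L_f(α) : f ∈ ℱ} be the family of α-level sets. Suppose dim(𝒞_α) < ∞ for every α ∈ ℝ. If μ is a probability measure on (𝒳, 𝒮) with ∫ F dμ < ∞, then N_[](ε, ℱ, μ) < ∞ for every ε > 0. -/

import Mathlib

open MeasureTheory Set Filter

/-- `𝒞` shatters the finite set `D` if every subset of `D` is cut out by some `C ∈ 𝒞`. -/
def Shatters {X : Type*} (𝒞 : Set (Set X)) (D : Finset X) : Prop :=
  ∀ B ⊆ D, ∃ C ∈ 𝒞, ∀ x ∈ D, x ∈ C ↔ x ∈ B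

/-- `𝒞` has finite VC dimension: the cardinalities of shattered finite sets are bounded. -/
def FiniteVC {X : Type*} (𝒞 : Set (Set X)) : Prop :=
  ∃ k : ℕ, ∀ D : Finset X, Shatters 𝒞 D → D.card ≤ k

/-- `π` is a finite measurable partition of the whole space. -/
def IsFinitePartition {X : Type*} [MeasurableSpace X] (π : Set (Set X)) : Prop :=
  π.Finite ∧ (∀ A ∈ π, MeasurableSet A) ∧
    (∀ A ∈ π, ∀ B ∈ π, A ≠ B → Disjoint A B) ∧ ⋃₀ π = Set.univ

/-- The `π`-boundary of `C`: union of the cells of `π` meeting both `C` and `Cᶜ`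
with positive measure. -/
def piBoundary {X : Type*} [MeasurableSpace X] (μ : Measure X) (π : Set (Set X))
    (C : Set X) : Set X :=
  ⋃₀ {A ∈ π | 0 < μ (A ∩ C) * μ (A ∩ Cᶜ)}

/-- `𝒞` is finitely approximable w.r.t. `μ`: for every `ε > 0` there is a finite measurable
partition `π` such that `μ (∂(C : π)) ≤ ε` for every `C ∈ 𝒞`. -/
def FinitelyApproximable {X : Type*} [MeasurableSpace X] (μ : Measure X)
    (𝒞 : Set (Set X)) : Prop :=
  ∀ ε : ENNReal, 0 < ε → ∃ π : Set (Set X), IsFinitePartition π ∧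
    ∀ C ∈ 𝒞, μ (piBoundary μ π C) ≤ ε

/-- A family of sets is separable if some countable subfamily `𝒞₀ ⊆ 𝒞` is pointwise dense:
every `C ∈ 𝒞` is a pointwise limit (of indicator functions) of a sequence from `𝒞₀`. -/
def SeparableSetFamily {X : Type*} (𝒞 : Set (Set X)) : Prop :=
  ∃ 𝒞₀ ⊆ 𝒞, 𝒞₀.Countable ∧ ∀ C ∈ 𝒞, ∃ g : ℕ → Set X, (∀ n, g n ∈ 𝒞₀) ∧
    ∀ x : X, ∀ᶠ n in Filter.atTop, (x ∈ g n ↔ x ∈ C)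

/-- The family `ℱ` of real functions has finite bracketing numbers w.r.t. `μ`: for every
`ε > 0` finitely many `ε`-brackets (pairs of measurable functions `g ≤ h` with
`∫ (h - g) dμ ≤ ε`) cover `ℱ`. -/
def FiniteBracketing {X : Type*} [MeasurableSpace X] (μ : Measure X)
    (ℱ : Set (X → ℝ)) : Prop :=
  ∀ ε : ℝ, 0 < ε → ∃ n : ℕ, ∃ g h : Fin n → X → ℝ,
    (∀ i, Measurable (g i) ∧ Measurable (h i) ∧ (∀ x, g i x ≤ h i x) ∧
      ∫⁻ x, ENNReal.ofReal (h i x - g i x) ∂μ ≤ ENNReal.ofReal ε) ∧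
    ∀ f ∈ ℱ, ∃ i, ∀ x, g i x ≤ f x ∧ f x ≤ h i x

/-- A family `ℱ` of real functions is separable if some countable subfamily `ℱ₀ ⊆ ℱ` is
pointwise dense in `ℱ`. -/
def SeparableFamily {X : Type*} (ℱ : Set (X → ℝ)) : Prop :=
  ∃ ℱ₀ ⊆ ℱ, ℱ₀.Countable ∧ ∀ f ∈ ℱ, ∃ g : ℕ → (X → ℝ), (∀ n, g n ∈ ℱ₀) ∧
    ∀ x : X, Filter.Tendsto (fun n => g n x) Filter.atTop (nhds (f x))

/-- The region on which the members of `C` indexed by `P` disagree. -/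
def disagreement {X ι : Type*} (C : ι → Set X) (P : Set ι) : Set X :=
  (⋃ i ∈ P, C i) ∩ ⋃ i ∈ P, (C i)ᶜ

theorem disagreement_mono {X ι : Type*} (C : ι → Set X) {P Q : Set ι} (h : P ⊆ Q) :
    disagreement C P ⊆ disagreement C Q :=
  inter_subset_inter (biUnion_subset_biUnion_left h) (biUnion_subset_biUnion_left h)

theorem measurableSet_disagreement {X ι : Type*} [MeasurableSpace X] [Countable ι]
    {C : ι → Set X} (hC : ∀ i, MeasurableSet (C i)) (P : Set ι) :
    MeasurableSet (disagreement C P) :=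
  (MeasurableSet.biUnion P.to_countable fun i _ => hC i).inter
    (MeasurableSet.biUnion P.to_countable fun i _ => (hC i).compl)

/-- `P` is covered by finitely many sets of indices whose disagreement regions have measure
at most `ε`. -/
def FinitelyCoverable {X ι : Type*} [MeasurableSpace X] (μ : Measure X) (C : ι → Set X)
    (ε : ENNReal) (P : Set ι) : Prop :=
  ∃ S : Set (Set ι), S.Finite ∧ P ⊆ ⋃₀ S ∧ ∀ Q ∈ S, μ (disagreement C Q) ≤ ε

/-- If all the sets of an ultrafilter have non-negligible disagreement regions, then these regions
have a common essential lower bound of positive measure. -/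
theorem exists_essential_disagreement {X ι : Type*} [MeasurableSpace X] [Countable ι]
    (μ : Measure X) [IsFiniteMeasure μ] {C : ι → Set X} (hC : ∀ i, MeasurableSet (C i))
    {ε : ENNReal} (hε : 0 < ε) (U : Filter ι)
    (hU : ∀ P ∈ U, ε ≤ μ (disagreement C P)) :
    ∃ W : Set X, 0 < μ W ∧ ∀ P ∈ U, μ (W \ disagreement C P) = 0 := by
  set m : ENNReal := ⨅ P : U.sets, μ (disagreement C P) with hm
  have hεm : ε ≤ m := le_iInf fun P => hU P P.2
  have hle : ∀ P ∈ U, m ≤ μ (disagreement C P) := fun P hP => iInf_le _ (⟨P, hP⟩ : U.sets)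
  have hmtop : m ≠ ⊤ := ne_top_of_le_ne_top (measure_ne_top μ _) (hle _ univ_mem)
  have hseq : ∀ n : ℕ, ∃ P ∈ U, μ (disagreement C P) < m + (n + 1 : ENNReal)⁻¹ := by
    intro n
    have : m < m + (n + 1 : ENNReal)⁻¹ :=
      ENNReal.lt_add_right hmtop (by simp)
    obtain ⟨P, hP⟩ := iInf_lt_iff.1 (hm ▸ this)
    exact ⟨P, P.2, hP⟩
  choose P hPU hP using hseq
  have hinter : ∀ Q ∈ U, m ≤ μ ((⋂ n, disagreement C (P n)) ∩ disagreement C Q) := by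
    intro Q hQ
    set T : ℕ → Set ι := fun n => (⋂ k ∈ Finset.range n, P k) ∩ Q
    have hT : ∀ n, T n ∈ U := fun n =>
      inter_mem ((biInter_finset_mem _).2 fun k _ => hPU k) hQ
    have hTanti : Antitone T := fun a b hab =>
      inter_subset_inter_left _ (biInter_subset_biInter_left fun k hk =>
        Finset.mem_coe.2 (Finset.range_subset_range.2 hab hk))
    have hlim := tendsto_measure_iInter_atTop (μ := μ) (s := fun n => disagreement C (T n))
      (fun n => (measurableSet_disagreement hC _).nullMeasurableSet)
      (fun a b hab => disagreement_mono C (hTanti hab)) ⟨0, measure_ne_top μ _⟩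
    refine (ge_of_tendsto' hlim fun n => hle _ (hT n)).trans (measure_mono ?_)
    refine subset_inter (subset_iInter fun n => ?_) ?_
    · refine (iInter_subset _ (n + 1)).trans (disagreement_mono C ?_)
      exact inter_subset_left.trans (biInter_subset_of_mem (by simp))
    · exact (iInter_subset _ 0).trans (disagreement_mono C inter_subset_right)
  have hW : μ (⋂ n, disagreement C (P n)) ≤ m := by
    have hlim : Tendsto (fun n : ℕ => m + (n + 1 : ENNReal)⁻¹) atTop (nhds (m + 0)) := by
      refine Tendsto.const_add _ ?_
      have := (tendsto_add_atTop_iff_nat 1).2 ENNReal.tendsto_inv_nat_nhds_zero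
      simpa using this
    rw [add_zero] at hlim
    exact ge_of_tendsto' hlim fun n => (measure_mono (iInter_subset _ n)).trans (hP n).le
  refine ⟨⋂ n, disagreement C (P n),
    (hε.trans_le hεm).trans_le ((hinter _ univ_mem).trans (measure_mono inter_subset_left)), ?_⟩
  intro Q hQ
  have hsplit := measure_inter_add_sdiff (μ := μ) (⋂ n, disagreement C (P n))
    (measurableSet_disagreement hC Q)
  have h1 : m + μ ((⋂ n, disagreement C (P n)) \ disagreement C Q) ≤ m + 0 := by
    rw [add_zero]
    calc _ ≤ _ := add_le_add_left (hinter Q hQ) _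
      _ = _ := hsplit
      _ ≤ m := hW
  exact nonpos_iff_eq_zero.1 ((ENNReal.add_le_add_iff_left hmtop).1 h1)

/-- A countable family of measurable sets which is not finitely coverable contains arbitrarily
large Boolean independent subfamilies. -/
theorem exists_independent_of_not_finitelyCoverable {X ι : Type*} [MeasurableSpace X]
    [Countable ι] (μ : Measure X) [IsFiniteMeasure μ] {C : ι → Set X}
    (hC : ∀ i, MeasurableSet (C i)) {ε : ENNReal} (hε : 0 < ε)
    (hcov : ¬ FinitelyCoverable μ C ε univ) (n : ℕ) :
    ∃ a : Fin n → ι, ∀ s : Fin n → Prop, ∃ x, ∀ i, x ∈ C (a i) ↔ s i := by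
  let 𝓕 : Filter ι := Filter.comk (FinitelyCoverable μ C ε)
    ⟨∅, finite_empty, by simp, by simp⟩
    (fun P ⟨S, hS, hPS, h⟩ Q hQ => ⟨S, hS, Subset.trans hQ hPS, h⟩)
    (fun P ⟨S, hS, hPS, h⟩ Q ⟨S', hS', hQS, h'⟩ =>
      ⟨S ∪ S', hS.union hS', by rw [sUnion_union]; exact union_subset_union hPS hQS,
        fun R hR => hR.elim (h R) (h' R)⟩)
  have h𝓕 : 𝓕.NeBot := by
    refine ⟨fun hbot => hcov ?_⟩
    have : (∅ : Set ι) ∈ 𝓕 := by rw [hbot]; exact mem_bot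
    rw [← compl_empty]
    exact this
  let U : Ultrafilter ι := Ultrafilter.of 𝓕
  have hU : ∀ P ∈ (U : Filter ι), ε ≤ μ (disagreement C P) := by
    intro P hP
    by_contra! hlt
    have : Pᶜ ∈ 𝓕 := by
      change FinitelyCoverable μ C ε Pᶜᶜ
      rw [compl_compl]
      exact ⟨{P}, finite_singleton P, by simp, by simpa using hlt.le⟩
    have h2 := inter_mem hP (Ultrafilter.of_le 𝓕 this)
    rw [inter_compl_self] at h2
    exact U.empty_notMem h2
  obtain ⟨W, hWpos, hW⟩ := exists_essential_disagreement μ hC hε U hU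
  have key : ∀ D : ι → Set X, (∀ P, disagreement C P ⊆ ⋃ i ∈ P, D i) →
      ∀ A ⊆ W, 0 < μ A → ∀ᶠ j in (U : Filter ι), 0 < μ (A ∩ D j) := by
    intro D hD A hAW hA
    by_contra hnot
    have hP : {j | μ (A ∩ D j) = 0} ∈ (U : Filter ι) := by
      have := Ultrafilter.eventually_not.2 hnot
      filter_upwards [this] with j hj
      exact nonpos_iff_eq_zero.1 (not_lt.1 hj)
    refine hA.ne' (measure_mono_null (t := (W \ disagreement C {j | μ (A ∩ D j) = 0}) ∪
      ⋃ j ∈ {j | μ (A ∩ D j) = 0}, A ∩ D j) ?_ (measure_union_null (hW _ hP) ?_))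
    · intro x hx
      by_cases hxd : x ∈ disagreement C {j | μ (A ∩ D j) = 0}
      · right
        have := hD _ hxd
        simp only [mem_iUnion] at this ⊢
        obtain ⟨i, hi, hxi⟩ := this
        exact ⟨i, hi, hx, hxi⟩
      · exact Or.inl ⟨hAW hx, hxd⟩
    · exact (measure_biUnion_null_iff (to_countable _)).2 fun j hj => hj
  have main : ∀ n : ℕ, ∃ a : Fin n → ι, ∀ s : Fin n → Prop,
      0 < μ (W ∩ {x | ∀ i, x ∈ C (a i) ↔ s i}) := by
    intro n
    induction n with
    | zero => exact ⟨Fin.elim0, fun s => by simpa using hWpos⟩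
    | succ n ih =>
      obtain ⟨a, ha⟩ := ih
      have h1 : ∀ᶠ j in (U : Filter ι), ∀ s : Fin n → Prop,
          0 < μ ((W ∩ {x | ∀ i, x ∈ C (a i) ↔ s i}) ∩ C j) :=
        eventually_all.2 fun s => key C (fun P => inter_subset_left) _ inter_subset_left (ha s)
      have h2 : ∀ᶠ j in (U : Filter ι), ∀ s : Fin n → Prop,
          0 < μ ((W ∩ {x | ∀ i, x ∈ C (a i) ↔ s i}) ∩ (C j)ᶜ) :=
        eventually_all.2 fun s =>
          key (fun j => (C j)ᶜ) (fun P => inter_subset_right) _ inter_subset_left (ha s)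
      obtain ⟨j, hj1, hj2⟩ := (h1.and h2).exists
      refine ⟨Fin.cons j a, fun s => ?_⟩
      by_cases hs : s 0
      · refine (hj1 fun i => s i.succ).trans_le (measure_mono ?_)
        rintro x ⟨⟨hxW, hx⟩, hxj⟩
        exact ⟨hxW, Fin.cases (by simpa [hs] using hxj) (by simpa using hx)⟩
      · refine (hj2 fun i => s i.succ).trans_le (measure_mono ?_)
        rintro x ⟨⟨hxW, hx⟩, hxj⟩
        exact ⟨hxW, Fin.cases (by simpa [hs] using hxj) (by simpa using hx)⟩
  obtain ⟨a, ha⟩ := main n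
  refine ⟨a, fun s => ?_⟩
  obtain ⟨x, hx⟩ := nonempty_of_measure_ne_zero (ha s).ne'
  exact ⟨x, hx.2⟩

/-- Boolean independent subfamilies of arbitrary size force infinite VC dimension. -/
theorem not_finiteVC_of_independent {X ι : Type*} (C : ι → Set X)
    (h : ∀ n : ℕ, ∃ a : Fin n → ι, ∀ s : Fin n → Prop, ∃ x, ∀ i, x ∈ C (a i) ↔ s i) :
    ¬ FiniteVC (range C) := by
  classical
  rintro ⟨k, hk⟩
  obtain ⟨a, ha⟩ := h (Fintype.card (Finset (Fin (k + 1))))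
  let e := Fintype.equivFin (Finset (Fin (k + 1)))
  choose x hx using fun i : Fin (k + 1) => ha fun l => i ∈ e.symm l
  have hx' : ∀ i S, x i ∈ C (a (e S)) ↔ i ∈ S := fun i S => by simpa using hx i (e S)
  have hinj : Function.Injective x := by
    intro i j hij
    have := (hx' i {j}).1 (hij ▸ (hx' j {j}).2 (by simp))
    simpa using this
  have := hk (Finset.univ.image x) fun B _ =>
    ⟨C (a (e (Finset.univ.filter fun i => x i ∈ B))), mem_range_self _, fun y hy => by
      obtain ⟨i, -, rfl⟩ := Finset.mem_image.1 hy
      simp [hx']⟩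
  rw [Finset.card_image_of_injective _ hinj] at this
  simp at this

theorem FiniteVC.mono {X : Type*} {𝒞 𝒟 : Set (Set X)} (h : 𝒞 ⊆ 𝒟) (hD : FiniteVC 𝒟) :
    FiniteVC 𝒞 := by
  obtain ⟨k, hk⟩ := hD
  refine ⟨k, fun D hDs => hk D fun B hB => ?_⟩
  obtain ⟨c, hc, hcB⟩ := hDs B hB
  exact ⟨c, h hc, hcB⟩

/-- Finitely many countable families with a common index set and finite VC dimension admit a
common finite cover of the index set with small disagreement regions. -/
theorem exists_common_cover {X ι J : Type*} [MeasurableSpace X] [Countable ι]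
    (μ : Measure X) [IsFiniteMeasure μ] (C : J → ι → Set X)
    (hC : ∀ j i, MeasurableSet (C j i)) (hVC : ∀ j, FiniteVC (range (C j)))
    {ε : ENNReal} (hε : 0 < ε) (s : Finset J) :
    ∃ S : Set (Set ι), S.Finite ∧ ⋃₀ S = univ ∧
      ∀ Q ∈ S, ∀ j ∈ s, μ (disagreement (C j) Q) ≤ ε := by
  classical
  induction s using Finset.induction_on with
  | empty => exact ⟨{univ}, finite_singleton _, by simp, by simp⟩
  | insert j s _ ih =>
    obtain ⟨S, hS, hSu, hSs⟩ := ih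
    have hj : FinitelyCoverable μ (C j) ε univ := by
      by_contra hcov
      exact not_finiteVC_of_independent (C j)
        (exists_independent_of_not_finitelyCoverable μ (hC j) hε hcov) (hVC j)
    obtain ⟨T, hT, hTu, hTj⟩ := hj
    refine ⟨image2 (· ∩ ·) S T, hS.image2 _ hT, eq_univ_of_forall fun i => ?_, ?_⟩
    · obtain ⟨P, hP, hiP⟩ := hSu ▸ mem_univ i
      obtain ⟨Q, hQ, hiQ⟩ := hTu (mem_univ i)
      exact ⟨P ∩ Q, mem_image2_of_mem hP hQ, hiP, hiQ⟩
    · rintro _ ⟨P, hP, Q, hQ, rfl⟩ l hl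
      rcases Finset.mem_insert.1 hl with rfl | hl
      · exact (measure_mono (disagreement_mono _ inter_subset_right)).trans (hTj Q hQ)
      · exact (measure_mono (disagreement_mono _ inter_subset_left)).trans (hSs P hP l hl)

/-- Finite bracketing passes to pointwise sequential closures. -/
theorem FiniteBracketing.of_pointwise_dense {X : Type*} [MeasurableSpace X] {μ : Measure X}
    {ℱ₀ ℱ : Set (X → ℝ)} (h₀ : FiniteBracketing μ ℱ₀)
    (hd : ∀ f ∈ ℱ, ∃ u : ℕ → (X → ℝ), (∀ n, u n ∈ ℱ₀) ∧
      ∀ x : X, Tendsto (fun n => u n x) atTop (nhds (f x))) :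
    FiniteBracketing μ ℱ := by
  intro ε hε
  obtain ⟨n, g, h, hgh, hcov⟩ := h₀ ε hε
  refine ⟨n, g, h, hgh, fun f hf => ?_⟩
  obtain ⟨u, hu, hlim⟩ := hd f hf
  choose c hc using fun k => hcov (u k) (hu k)
  obtain ⟨i, hi⟩ : ∃ i, ∃ᶠ k in atTop, c k = i := by
    by_contra! hne
    obtain ⟨k, hk⟩ := (eventually_all.2 hne).exists
    exact hk (c k) rfl
  refine ⟨i, fun x => ⟨?_, ?_⟩⟩
  · exact isClosed_Ici.mem_of_frequently_of_tendsto
      (hi.mono fun k hk => by rw [← hk]; exact (hc k x).1) (hlim x)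
  · exact isClosed_Iic.mem_of_frequently_of_tendsto
      (hi.mono fun k hk => by rw [← hk]; exact (hc k x).2) (hlim x)

/-- Two reals in `[-K δ, K δ]` lying on the same side of each grid point `j δ`, `|j| ≤ K`, are
within `δ` of each other. -/
theorem le_add_of_same_grid_side {δ a b : ℝ} (hδ : 0 < δ) {K : ℤ} (ha : |a| ≤ K * δ)
    (h : ∀ j ∈ Finset.Icc (-K) K, a ≤ j * δ → b ≤ j * δ) : b ≤ a + δ := by
  have ha' := abs_le.1 ha
  have h1 : a ≤ ⌈a / δ⌉ * δ := (div_le_iff₀ hδ).1 (Int.le_ceil _)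
  have h2 : ⌈a / δ⌉ * δ < a + δ := by
    have := mul_lt_mul_of_pos_right (Int.ceil_lt_add_one (a / δ)) hδ
    rwa [add_mul, div_mul_cancel₀ _ hδ.ne', one_mul] at this
  have h3 : ⌈a / δ⌉ ≤ K := Int.ceil_le.2 ((div_le_iff₀ hδ).2 ha'.2)
  have h4 : -K ≤ ⌈a / δ⌉ := by
    have : ((-K : ℤ) : ℝ) ≤ ⌈a / δ⌉ := by
      refine le_trans ?_ (Int.le_ceil _)
      rw [le_div_iff₀ hδ]
      push_cast
      linarith [ha'.1]
    exact_mod_cast this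
  exact (h _ (Finset.mem_Icc.2 ⟨h4, h3⟩) h1).trans h2.le

theorem exists_nat_measure_lt {X : Type*} [MeasurableSpace X] (μ : Measure X)
    [IsFiniteMeasure μ] {F : X → ℝ} (hF : Measurable F) {η : ENNReal} (hη : 0 < η) (δ : ℝ)
    (hδ : 0 < δ) : ∃ K : ℕ, μ {x | K * δ < F x} < η := by
  have hlim := tendsto_measure_iInter_atTop (μ := μ) (s := fun n : ℕ => {x | n * δ < F x})
    (fun n => (measurableSet_lt measurable_const hF).nullMeasurableSet)
    (fun a b hab x (hx : b * δ < F x) => show a * δ < F x from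
      lt_of_le_of_lt (by gcongr) hx) ⟨0, measure_ne_top μ _⟩
  have hempty : ⋂ n : ℕ, {x | n * δ < F x} = ∅ := by
    refine eq_empty_of_forall_notMem fun x hx => ?_
    obtain ⟨n, hn⟩ := exists_nat_ge (F x / δ)
    exact (mem_iInter.1 hx n).not_ge ((div_le_iff₀ hδ).1 hn)
  rw [hempty, measure_empty] at hlim
  exact (hlim.eventually (gt_mem_nhds hη)).exists

theorem finiteBracketing_of_countable {X : Type*} [MeasurableSpace X]
    (ℱ : Set (X → ℝ)) (hcount : ℱ.Countable) (hmeas : ∀ f ∈ ℱ, Measurable f)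
    (F : X → ℝ) (hF : Measurable F)
    (henv : ∀ f ∈ ℱ, ∀ x, |f x| ≤ F x)
    (hlevel : ∀ α : ℝ, FiniteVC ((fun f => {x | f x ≤ α}) '' ℱ))
    (μ : Measure X) [IsProbabilityMeasure μ] (hFint : Integrable F μ) :
    FiniteBracketing μ ℱ := by
  have : Countable ℱ := hcount.to_subtype
  intro ε hε
  have hδ : 0 < ε / 2 := half_pos hε
  obtain ⟨η, hη, hηF⟩ := exists_pos_setLIntegral_lt_of_measure_lt
    (f := fun x => ENNReal.ofReal (2 * F x)) (μ := μ)
    (hFint.const_mul 2).lintegral_lt_top.ne (ENNReal.ofReal_pos.2 hδ).ne'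
  obtain ⟨K, hK⟩ := exists_nat_measure_lt μ hF (ENNReal.half_pos hη.ne') (ε / 2) hδ
  set s : Finset ℤ := Finset.Icc (-(K : ℤ)) K
  let C : ℤ → ℱ → Set X := fun j f => {x | f.1 x ≤ j * (ε / 2)}
  have hC : ∀ j f, MeasurableSet (C j f) := fun j f =>
    measurableSet_le (hmeas f f.2) measurable_const
  obtain ⟨S, hS, hSu, hSs⟩ := exists_common_cover μ C hC
    (fun j => (hlevel (j * (ε / 2))).mono (by rintro _ ⟨f, rfl⟩; exact ⟨f, f.2, rfl⟩))
    (ε := η / 2 / s.card)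
    (ENNReal.div_pos (ENNReal.half_pos hη.ne').ne' (ENNReal.natCast_ne_top _)) s
  have : Finite S := hS
  obtain ⟨n, ⟨e⟩⟩ := Finite.exists_equiv_fin S
  have hbelow : ∀ (Q : Set ℱ) (x : X), BddBelow (range fun f : Q => f.1.1 x) := fun Q x =>
    ⟨-F x, by rintro _ ⟨f, rfl⟩; exact (abs_le.1 (henv _ f.1.2 x)).1⟩
  have habove : ∀ (Q : Set ℱ) (x : X), BddAbove (range fun f : Q => f.1.1 x) := fun Q x =>
    ⟨F x, by rintro _ ⟨f, rfl⟩; exact (abs_le.1 (henv _ f.1.2 x)).2⟩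
  let lo : Set ℱ → X → ℝ := fun Q x => ⨅ f : Q, f.1.1 x
  let hi : Set ℱ → X → ℝ := fun Q x => ⨆ f : Q, f.1.1 x
  have hlo : ∀ Q, Measurable (lo Q) := fun Q =>
    Measurable.iInf (f := fun f : Q => f.1.1) fun f => hmeas _ f.1.2
  have hhi : ∀ Q, Measurable (hi Q) := fun Q =>
    Measurable.iSup (f := fun f : Q => f.1.1) fun f => hmeas _ f.1.2
  refine ⟨n, fun i => lo (e.symm i), fun i => hi (e.symm i),
    fun i => ⟨hlo _, hhi _, fun x => ?_, ?_⟩, fun f hf => ?_⟩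
  · rcases isEmpty_or_nonempty (e.symm i).1 with h | h
    · simp [lo, hi]
    · exact ciInf_le_ciSup (hbelow _ x) (habove _ x)
  · beta_reduce
    obtain ⟨Q, hQ⟩ := e.symm i
    set bad : Set X := {x | K * (ε / 2) < F x} ∪ ⋃ j ∈ s, disagreement (C j) Q with hbad
    have hbadm : MeasurableSet bad := (measurableSet_lt measurable_const hF).union
      (s.measurableSet_biUnion fun j _ => measurableSet_disagreement (hC j) Q)
    have hbadlt : μ bad < η := by
      have h2 : μ (⋃ j ∈ s, disagreement (C j) Q) ≤ η / 2 := by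
        refine (measure_biUnion_finset_le _ _).trans
          ((Finset.sum_le_card_nsmul _ _ _ (hSs Q hQ)).trans ?_)
        rw [nsmul_eq_mul]
        exact ENNReal.mul_div_le
      calc μ bad ≤ _ := measure_union_le _ _
        _ < η / 2 + η / 2 := ENNReal.add_lt_add_of_lt_of_le (measure_ne_top μ _) hK h2
        _ = η := ENNReal.add_halves η
    have hpt : ∀ x, ENNReal.ofReal (hi Q x - lo Q x) ≤
        ENNReal.ofReal (ε / 2) + bad.indicator (fun x => ENNReal.ofReal (2 * F x)) x := by
      intro x
      rcases isEmpty_or_nonempty Q with h | h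
      · simp [lo, hi]
      by_cases hx : x ∈ bad
      · rw [indicator_of_mem hx]
        refine le_add_left (ENNReal.ofReal_le_ofReal ?_)
        have h1 : hi Q x ≤ F x := ciSup_le fun f => (abs_le.1 (henv _ f.1.2 x)).2
        have h2 : -F x ≤ lo Q x := le_ciInf fun f => (abs_le.1 (henv _ f.1.2 x)).1
        linarith
      · refine le_add_right (ENNReal.ofReal_le_ofReal ?_)
        rw [hbad, mem_union, not_or] at hx
        have hFx : F x ≤ K * (ε / 2) := not_lt.1 hx.1
        have hgood : ∀ f f' : Q, f'.1.1 x ≤ f.1.1 x + ε / 2 := by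
          intro f f'
          refine le_add_of_same_grid_side (K := K) hδ
            (by exact_mod_cast (henv _ f.1.2 x).trans hFx) fun j hj hfj => ?_
          by_contra hf'j
          refine hx.2 (mem_biUnion hj ⟨mem_biUnion f.2 hfj, mem_biUnion f'.2 hf'j⟩)
        rw [sub_le_iff_le_add]
        refine ciSup_le fun f' => ?_
        have : f'.1.1 x - ε / 2 ≤ lo Q x := le_ciInf fun f => by
          linarith [hgood f f']
        linarith
    calc _ ≤ _ := lintegral_mono hpt
      _ = ENNReal.ofReal (ε / 2) * μ univ + ∫⁻ x in bad, ENNReal.ofReal (2 * F x) ∂μ := by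
        rw [lintegral_add_left measurable_const, lintegral_const, lintegral_indicator hbadm]
      _ ≤ ENNReal.ofReal (ε / 2) + ENNReal.ofReal (ε / 2) := by
        rw [measure_univ, mul_one]
        gcongr
        exact (hηF bad hbadlt).le
      _ = ENNReal.ofReal ε := by
        rw [← ENNReal.ofReal_add hδ.le hδ.le, add_halves]
  · obtain ⟨Q, hQ, hfQ⟩ := hSu ▸ mem_univ (⟨f, hf⟩ : ℱ)
    refine ⟨e ⟨Q, hQ⟩, fun x => ?_⟩
    beta_reduce
    rw [Equiv.symm_apply_apply]
    exact ⟨ciInf_le (hbelow Q x) ⟨⟨f, hf⟩, hfQ⟩, le_ciSup (habove Q x) ⟨⟨f, hf⟩, hfQ⟩⟩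

/-- **Proposition 1 (VC major families).** If every family of level sets
`𝒞_α = {{x | f x ≤ α} : f ∈ ℱ}` has finite VC dimension and the envelope `F` of the
separable family `ℱ` is `μ`-integrable, then `ℱ` has finite bracketing numbers w.r.t. `μ`. -/
theorem vc_major_finite_bracketing {X : Type*} [MeasurableSpace X]
    (ℱ : Set (X → ℝ)) (hmeas : ∀ f ∈ ℱ, Measurable f) (hsep : SeparableFamily ℱ)
    (F : X → ℝ) (hF : Measurable F) (hF0 : ∀ x, 0 ≤ F x)
    (henv : ∀ f ∈ ℱ, ∀ x, |f x| ≤ F x)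
    (hlevel : ∀ α : ℝ, FiniteVC ((fun f => {x | f x ≤ α}) '' ℱ))
    (μ : Measure X) [IsProbabilityMeasure μ] (hFint : Integrable F μ) :
    FiniteBracketing μ ℱ := by
  obtain ⟨ℱ₀, hsub, hcount, hd⟩ := hsep
  exact (finiteBracketing_of_countable ℱ₀ hcount (fun f hf => hmeas f (hsub hf)) F hF
    (fun f hf => henv f (hsub hf)) (fun α => (hlevel α).mono (image_mono hsub)) μ
    hFint).of_pointwise_dense hd
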